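/- Let (A, d) be a DGCA over a field of characteristic 0, i a quasi-BV operator of even degree −2k with l = [i, d] and [l, i] quasi-BV, and let B ⊆ A be a differential graded linear subspace closed under the bilinear operator R(a,b) = i(ab) − i(a)b − a i(b). Then the sub-DGLA (B[2k−1], d, [,]_l) is homotopy abelian (formal). -/

import Mathlib

/-!
STATEMENT 14 (Corollary 4.6 of the paper):
Let `(A, d)` be a DGCA over a field of characteristic 0, `i` a quasi-BV operator of even
degree `-2k` with `l = [i, d]` and `[l, i]` quasi-BV, and let `B ⊆ A` be a differential graded
linear subspace closed under the bilinear operator `R(a,b) = i(ab) - i(a)b - a i(b)`.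
Then the sub-DGLA `(B[2k-1], d, [,]_l)` is homotopy abelian (formal), where
`[a,b]_l = (-1)^{|a|}(l(ab) - l(a)b) - a l(b)` is the bracket generated by `l`.
-/

variable (K : Type) [Field K] [CharZero K]

structure DGLAon (L : Type) [AddCommGroup L] [Module K L] where
  grading : ℤ → Submodule K L
  internal : DirectSum.IsInternal grading
  d : L →ₗ[K] L
  d_deg : ∀ i : ℤ, ∀ x ∈ grading i, d x ∈ grading (i + 1)
  d_sq : d ∘ₗ d = 0
  bracket : L →ₗ[K] L →ₗ[K] L
  bracket_deg : ∀ i j : ℤ, ∀ x ∈ grading i, ∀ y ∈ grading j, bracket x y ∈ grading (i + j)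
  antisymm : ∀ i j : ℤ, ∀ x ∈ grading i, ∀ y ∈ grading j,
    bracket x y = -(((i * j).negOnePow : ℤ) • bracket y x)
  jacobi : ∀ i j : ℤ, ∀ x ∈ grading i, ∀ y ∈ grading j, ∀ z : L,
    bracket x (bracket y z)
      = bracket (bracket x y) z + ((i * j).negOnePow : ℤ) • bracket y (bracket x z)
  leibniz : ∀ i : ℤ, ∀ x ∈ grading i, ∀ y : L,
    d (bracket x y) = bracket (d x) y + (i.negOnePow : ℤ) • bracket x (d y)

structure DGLA where
  L : Type
  [inst1 : AddCommGroup L]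
  [inst2 : Module K L]
  str : DGLAon K L

attribute [instance] DGLA.inst1 DGLA.inst2

structure DGLAHom (G H : DGLA K) where
  f : G.L →ₗ[K] H.L
  compat_d : ∀ x, f (G.str.d x) = H.str.d (f x)
  compat_br : ∀ x y, f (G.str.bracket x y) = H.str.bracket (f x) (f y)
  compat_gr : ∀ i : ℤ, ∀ x ∈ G.str.grading i, f x ∈ H.str.grading i

def IsQuasiIso {G H : DGLA K} (φ : DGLAHom K G H) : Prop :=
  (∀ x : G.L, G.str.d x = 0 → (∃ z, φ.f x = H.str.d z) → ∃ w, x = G.str.d w) ∧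
  (∀ y : H.L, H.str.d y = 0 → ∃ x z, G.str.d x = 0 ∧ y = φ.f x + H.str.d z)

def ZigZag : DGLA K → DGLA K → Prop :=
  Relation.EqvGen (fun G H => ∃ φ : DGLAHom K G H, IsQuasiIso K φ)

def HomotopyAbelian (G : DGLA K) : Prop :=
  ∃ H : DGLA K, (∀ x y, H.str.bracket x y = 0) ∧ ZigZag K G H

variable {K}
variable {A : Type} [Ring A] [Algebra K A]

def IsGradedComm (𝒜 : ℤ → Submodule K A) : Prop :=
  DirectSum.IsInternal 𝒜 ∧ (1 : A) ∈ 𝒜 0 ∧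
    (∀ i j : ℤ, ∀ a ∈ 𝒜 i, ∀ b ∈ 𝒜 j, a * b ∈ 𝒜 (i + j)) ∧
    (∀ i j : ℤ, ∀ a ∈ 𝒜 i, ∀ b ∈ 𝒜 j, a * b = ((i * j).negOnePow : ℤ) • (b * a))

def HasDeg (𝒜 : ℤ → Submodule K A) (f : A →ₗ[K] A) (r : ℤ) : Prop :=
  ∀ i : ℤ, ∀ a ∈ 𝒜 i, f a ∈ 𝒜 (i + r)

def IsGDer (𝒜 : ℤ → Submodule K A) (r : ℤ) (f : A →ₗ[K] A) : Prop :=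
  ∀ i : ℤ, ∀ a ∈ 𝒜 i, ∀ b : A,
    f (a * b) = f a * b + ((r * i).negOnePow : ℤ) • (a * f b)

def gcomm (r i : ℤ) (f : A →ₗ[K] A) (a : A) : A →ₗ[K] A :=
  f ∘ₗ LinearMap.mulLeft K a - ((r * i).negOnePow : ℤ) • (LinearMap.mulLeft K a ∘ₗ f)

def IsDiff (𝒜 : ℤ → Submodule K A) (r : ℤ) : ℕ → (A →ₗ[K] A) → Prop
  | 0, f => ∀ i : ℤ, ∀ a ∈ 𝒜 i, gcomm r i f a = 0
  | k + 1, f => ∀ i : ℤ, ∀ a ∈ 𝒜 i, IsDiff 𝒜 (r + i) k (gcomm r i f a)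

def IsQuasiBV (𝒜 : ℤ → Submodule K A) (r : ℤ) (f : A →ₗ[K] A) : Prop :=
  HasDeg 𝒜 f r ∧ IsDiff 𝒜 r 2 f ∧ f 1 = 0

/-- The Koszul bracket `[a, b]_l = (-1)^{|a|}(l(ab) - l(a)b) - a l(b)` generated by `l`
(`i` = degree of `a`). -/
def koszulBr (l : A →ₗ[K] A) (i : ℤ) (a b : A) : A :=
  (i.negOnePow : ℤ) • (l (a * b) - l a * b) - a * l b



set_option linter.unusedSectionVars false
set_option linter.unusedSimpArgs false

section helper_glue
variable {K : Type} [Field K] {V N : Type} [AddCommGroup V] [Module K V]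
  [AddCommGroup N] [Module K N]

theorem sf_nop (n : ℤ) : ((n.negOnePow : ℤˣ) : ℤ) = if Even n then 1 else -1 := by
  split_ifs with h
  · rw [Int.negOnePow_even n h]; rfl
  · rw [Int.negOnePow_odd n (Int.not_even_iff_odd.mp h)]; rfl

noncomputable def sfGlue (gr : ℤ → Submodule K V) (h : DirectSum.IsInternal gr)
    (φ : ℤ → V →ₗ[K] N) : V →ₗ[K] N :=
  (DirectSum.toModule K ℤ N (fun n => φ n ∘ₗ (gr n).subtype)) ∘ₗ
    (LinearEquiv.ofBijective (DirectSum.coeLinearMap gr) h).symm.toLinearMap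

theorem sfGlue_apply (gr : ℤ → Submodule K V) (h : DirectSum.IsInternal gr)
    (φ : ℤ → V →ₗ[K] N) (n : ℤ) (x : V) (hx : x ∈ gr n) : sfGlue gr h φ x = φ n x := by
  have : (LinearEquiv.ofBijective (DirectSum.coeLinearMap gr) h).symm x
      = DirectSum.lof K ℤ (fun i => gr i) n ⟨x, hx⟩ := by
    rw [LinearEquiv.symm_apply_eq]
    exact (DirectSum.coeLinearMap_lof gr n ⟨x, hx⟩).symm
  rw [sfGlue, LinearMap.comp_apply, LinearEquiv.coe_coe, this, DirectSum.toModule_lof]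
  rfl

theorem sf_hom_induction (gr : ℤ → Submodule K V) (h : DirectSum.IsInternal gr)
    {P : V → Prop} (h0 : P 0) (hadd : ∀ x y, P x → P y → P (x + y))
    (hh : ∀ n, ∀ x ∈ gr n, P x) (x : V) : P x := by
  have hx : x ∈ ⨆ i, gr i := by rw [h.submodule_iSup_eq_top]; trivial
  exact Submodule.iSup_induction gr (motive := P) hx hh h0 hadd

theorem sf_internal (gr : ℤ → Submodule K V) (π : ℤ → V →ₗ[K] V)
    (h1 : ∀ n, ∀ x ∈ gr n, π n x = x) (h2 : ∀ n m, m ≠ n → ∀ x ∈ gr m, π n x = 0)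
    (ht : ⨆ i, gr i = ⊤) : DirectSum.IsInternal gr := by
  rw [DirectSum.isInternal_submodule_iff_iSupIndep_and_iSup_eq_top]
  refine ⟨?_, ht⟩
  intro n
  rw [Submodule.disjoint_def]
  intro x hx hx'
  rw [← h1 n x hx]
  have : (⨆ j, ⨆ (_ : j ≠ n), gr j) ≤ LinearMap.ker (π n) := by
    refine iSup_le fun j => iSup_le fun hj => ?_
    intro y hy
    exact h2 n j hj y hy
  exact this hx'

noncomputable def sfSigma (gr : ℤ → Submodule K V) (h : DirectSum.IsInternal gr) : V →ₗ[K] V :=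
  sfGlue gr h (fun n => ((n.negOnePow : ℤˣ) : ℤ) • LinearMap.id)

theorem sfSigma_apply (gr : ℤ → Submodule K V) (h : DirectSum.IsInternal gr)
    (n : ℤ) (x : V) (hx : x ∈ gr n) :
    sfSigma gr h x = ((n.negOnePow : ℤˣ) : ℤ) • x := by
  rw [sfSigma, sfGlue_apply gr h _ n x hx]; rfl

end helper_glue

/-- graded space with differential, sign operator, and homotopy `rho` -/
structure SfData (K : Type) [Field K] (V : Type) [AddCommGroup V] [Module K V] where
  gr : ℤ → Submodule K V
  internal : DirectSum.IsInternal gr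
  d : V →ₗ[K] V
  d_deg : ∀ i : ℤ, ∀ x ∈ gr i, d x ∈ gr (i + 1)
  d_sq : ∀ x, d (d x) = 0
  s : V →ₗ[K] V
  s_app : ∀ i : ℤ, ∀ x ∈ gr i, s x = ((i.negOnePow : ℤˣ) : ℤ) • x
  r : V →ₗ[K] V →ₗ[K] V
  r_deg : ∀ i j : ℤ, ∀ x ∈ gr i, ∀ y ∈ gr j, r x y ∈ gr (i + j - 1)
  r_anti : ∀ i j : ℤ, ∀ x ∈ gr i, ∀ y ∈ gr j, r x y = -(((i * j).negOnePow : ℤ) • r y x)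
  b : V →ₗ[K] V →ₗ[K] V
  b_def : ∀ x y, b x y = d (r x y) + r (d x) y + r (s x) (d y)
  mj : ∀ i j : ℤ, ∀ x ∈ gr i, ∀ y ∈ gr j, ∀ z : V,
    (i.negOnePow : ℤ) • b x (r y z) + r x (b y z) = b (r x y) z + r (b x y) z +
      ((i * j).negOnePow : ℤ) • ((j.negOnePow : ℤ) • b y (r x z) + r y (b x z))

namespace SfData
variable {K : Type} [Field K] [CharZero K] {V : Type} [AddCommGroup V] [Module K V]
  (S : SfData K V)

theorem s_deg (i : ℤ) (x : V) (hx : x ∈ S.gr i) : S.s x ∈ S.gr i := by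
  rw [S.s_app i x hx]
  exact zsmul_mem hx _

theorem b_deg (i j : ℤ) (x : V) (hx : x ∈ S.gr i) (y : V) (hy : y ∈ S.gr j) :
    S.b x y ∈ S.gr (i + j) := by
  rw [S.b_def]
  refine add_mem (add_mem ?_ ?_) ?_
  · have := S.d_deg _ _ (S.r_deg _ _ _ hx _ hy)
    convert this using 2; ring
  · have := S.r_deg _ _ _ (S.d_deg _ _ hx) _ hy
    convert this using 2; ring
  · have := S.r_deg _ _ _ (S.s_deg _ _ hx) _ (S.d_deg _ _ hy)
    convert this using 2; ring

theorem b_hom (i : ℤ) (x : V) (hx : x ∈ S.gr i) (y : V) :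
    S.b x y = S.d (S.r x y) + S.r (S.d x) y + (i.negOnePow : ℤ) • S.r x (S.d y) := by
  rw [S.b_def, S.s_app i x hx, map_zsmul, LinearMap.smul_apply]

theorem d_r (i : ℤ) (x : V) (hx : x ∈ S.gr i) (y : V) :
    S.d (S.r x y) = S.b x y - S.r (S.d x) y - (i.negOnePow : ℤ) • S.r x (S.d y) := by
  rw [S.b_hom i x hx]; abel

theorem b_anti (i j : ℤ) (x : V) (hx : x ∈ S.gr i) (y : V) (hy : y ∈ S.gr j) :
    S.b x y = -(((i * j).negOnePow : ℤ) • S.b y x) := by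
  rw [S.b_hom i x hx, S.b_hom j y hy, S.r_anti i j x hx y hy,
    S.r_anti _ j _ (S.d_deg _ _ hx) y hy, S.r_anti i _ x hx _ (S.d_deg _ _ hy)]
  simp only [sf_nop, Int.even_add, Int.even_mul, Int.not_even_one]
  by_cases hi : Even i <;> by_cases hj : Even j <;> simp [hi, hj] <;> abel

theorem b_leib (i : ℤ) (x : V) (hx : x ∈ S.gr i) (y : V) :
    S.d (S.b x y) = S.b (S.d x) y + (i.negOnePow : ℤ) • S.b x (S.d y) := by
  rw [S.b_hom i x hx, S.b_hom i x hx, S.b_hom _ _ (S.d_deg _ _ hx)]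
  simp only [sf_nop, Int.even_add, Int.not_even_one]
  by_cases hi : Even i <;> simp [hi, S.d_sq] <;> abel

theorem b_jac (i j : ℤ) (x : V) (hx : x ∈ S.gr i) (y : V) (hy : y ∈ S.gr j) (z : V) :
    S.b x (S.b y z) = S.b (S.b x y) z + ((i * j).negOnePow : ℤ) • S.b y (S.b x z) := by
  have h0 := congrArg S.d (S.mj i j x hx y hy z)
  have h1 := S.mj _ j _ (S.d_deg _ _ hx) y hy z
  have h2 := S.mj i _ x hx _ (S.d_deg _ _ hy) z
  have h3 := S.mj i j x hx y hy (S.d z)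
  have hxy := S.r_deg _ _ _ hx _ hy
  have bxy := S.b_deg _ _ _ hx _ hy
  suffices hs : (2 : K) • (S.b x (S.b y z)
      - (S.b (S.b x y) z + ((i * j).negOnePow : ℤ) • S.b y (S.b x z))) = 0 by
    have := (smul_eq_zero.mp hs).resolve_left two_ne_zero
    exact sub_eq_zero.mp this
  simp only [map_add, map_zsmul, S.b_leib i x hx, S.b_leib j y hy, S.d_r i x hx, S.d_r j y hy,
    S.b_leib _ _ hxy, S.d_r _ _ bxy, map_sub, LinearMap.sub_apply, LinearMap.add_apply,
    LinearMap.smul_apply] at h0 h1 h2 h3 ⊢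
  simp only [sf_nop, Int.even_add, Int.even_mul, Int.not_even_one, Int.even_sub] at h0 h1 h2 h3 ⊢
  by_cases hi : Even i <;> by_cases hj : Even j <;>
    simp only [hi, hj, iff_true, iff_false, or_true, true_or, or_self, if_true, if_false,
      not_true_eq_false, not_false_eq_true, one_smul, neg_smul, iff_self, true_iff, false_iff] at h0 h1 h2 h3 ⊢
  · linear_combination (norm := module) h0 + h1 + h2 + h3
  · linear_combination (norm := module) h0 + h1 + h2 - h3
  · linear_combination (norm := module) h0 + h1 - h2 - h3
  · linear_combination (norm := module) h0 + h1 - h2 + h3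

end SfData


namespace SfData
/-- `V[t, dt]`: `inl m` is `t^m`, `inr m` is `dt t^m`. -/
abbrev Path (V : Type) [AddCommGroup V] : Type := (ℕ ⊕ ℕ) →₀ V

noncomputable abbrev sl (K : Type) [Field K] {V : Type} [AddCommGroup V] [Module K V]
    (i : ℕ ⊕ ℕ) : V →ₗ[K] Path V := Finsupp.lsingle i

theorem path_ind {K : Type} [Field K] {V : Type} [AddCommGroup V] [Module K V]
    {P : Path V → Prop} (h0 : P 0) (hadd : ∀ x y, P x → P y → P (x + y))
    (hl : ∀ m a, P (sl K (.inl m) a)) (hr : ∀ m a, P (sl K (.inr m) a)) (x : Path V) : P x := by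
  induction x using Finsupp.induction_linear with
  | zero => exact h0
  | add f g hf hg => exact hadd f g hf hg
  | single i a => cases i with
    | inl m => exact hl m a
    | inr m => exact hr m a

end SfData

namespace SfData
variable {K : Type} [Field K] [CharZero K] {V : Type} [AddCommGroup V] [Module K V]
  (S : SfData K V)

noncomputable def pD : Path V →ₗ[K] Path V :=
  Finsupp.lsum K (fun i => match i with
    | Sum.inl m => sl K (.inl m) ∘ₗ S.d + (m : K) • sl K (.inr (m - 1))
    | Sum.inr m => - (sl K (.inr m) ∘ₗ S.d))

theorem pD_inl (m : ℕ) (a : V) : S.pD (sl K (.inl m) a)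
    = sl K (.inl m) (S.d a) + (m : K) • sl K (.inr (m - 1)) a := by
  simp [pD]

theorem pD_inr (m : ℕ) (a : V) : S.pD (sl K (.inr m) a) = - sl K (.inr m) (S.d a) := by
  simp [pD]

noncomputable def pBeta (i j : ℕ ⊕ ℕ) : V →ₗ[K] V →ₗ[K] Path V :=
  match i, j with
  | .inl m, .inl n => S.b.compr₂ (sl K (.inl (m + n + 1))) + S.r.compr₂ (sl K (.inr (m + n)))
  | .inr m, .inl n => S.b.compr₂ (sl K (.inr (m + n + 1)))
  | .inl m, .inr n => (S.b ∘ₗ S.s).compr₂ (sl K (.inr (m + n + 1)))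
  | .inr _, .inr _ => 0

noncomputable def pB : Path V →ₗ[K] Path V →ₗ[K] Path V :=
  Finsupp.lsum K (fun i => (Finsupp.lsum K (fun j => (S.pBeta i j).flip)).flip)

theorem pB_sl (i j : ℕ ⊕ ℕ) (a b : V) : S.pB (sl K i a) (sl K j b) = S.pBeta i j a b := by
  simp [pB]

theorem pB_ll (m n : ℕ) (a b : V) : S.pB (sl K (.inl m) a) (sl K (.inl n) b)
    = sl K (.inl (m + n + 1)) (S.b a b) + sl K (.inr (m + n)) (S.r a b) := by
  rw [pB_sl]; rfl

theorem pB_rl (m n : ℕ) (a b : V) : S.pB (sl K (.inr m) a) (sl K (.inl n) b)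
    = sl K (.inr (m + n + 1)) (S.b a b) := by
  rw [pB_sl]; rfl

theorem pB_lr (m n : ℕ) (a b : V) : S.pB (sl K (.inl m) a) (sl K (.inr n) b)
    = sl K (.inr (m + n + 1)) (S.b (S.s a) b) := by
  rw [pB_sl]; rfl

theorem pB_rr (m n : ℕ) (a b : V) : S.pB (sl K (.inr m) a) (sl K (.inr n) b) = 0 := by
  rw [pB_sl]; rfl

def pSet (n : ℤ) : Set (Path V) :=
  {x | (∃ m, ∃ a ∈ S.gr n, x = sl K (.inl m) a) ∨ (∃ m, ∃ a ∈ S.gr (n - 1), x = sl K (.inr m) a)}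

noncomputable def pGr (n : ℤ) : Submodule K (Path V) := Submodule.span K (S.pSet n)

theorem mem_l (n : ℤ) (m : ℕ) (a : V) (ha : a ∈ S.gr n) : sl K (.inl m) a ∈ S.pGr n :=
  Submodule.subset_span (Or.inl ⟨m, a, ha, rfl⟩)

theorem mem_r (n : ℤ) (m : ℕ) (a : V) (ha : a ∈ S.gr (n - 1)) : sl K (.inr m) a ∈ S.pGr n :=
  Submodule.subset_span (Or.inr ⟨m, a, ha, rfl⟩)

theorem gr_ind (n : ℤ) {P : Path V → Prop} (h0 : P 0) (hadd : ∀ x y, P x → P y → P (x + y))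
    (hsm : ∀ (c : K) x, P x → P (c • x))
    (hl : ∀ m, ∀ a ∈ S.gr n, P (sl K (.inl m) a))
    (hr : ∀ m, ∀ a ∈ S.gr (n - 1), P (sl K (.inr m) a)) (x : Path V) (hx : x ∈ S.pGr n) : P x := by
  induction hx using Submodule.span_induction with
  | mem x h =>
    rcases h with ⟨m, a, ha, rfl⟩ | ⟨m, a, ha, rfl⟩
    · exact hl m a ha
    · exact hr m a ha
  | zero => exact h0
  | add x y _ _ hx hy => exact hadd x y hx hy
  | smul c x _ hx => exact hsm c x hx

noncomputable def prj (n : ℤ) : V →ₗ[K] V :=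
  sfGlue S.gr S.internal (fun m => if m = n then LinearMap.id else 0)

noncomputable def pPrj (n : ℤ) : Path V →ₗ[K] Path V :=
  Finsupp.lsum K (fun i => match i with
    | Sum.inl m => sl K (.inl m) ∘ₗ S.prj n
    | Sum.inr m => sl K (.inr m) ∘ₗ S.prj (n - 1))

theorem pPrj_l (n : ℤ) (m : ℕ) (a : V) :
    S.pPrj n (sl K (.inl m) a) = sl K (.inl m) (S.prj n a) := by
  simp [pPrj]

theorem pPrj_r (n : ℤ) (m : ℕ) (a : V) :
    S.pPrj n (sl K (.inr m) a) = sl K (.inr m) (S.prj (n - 1) a) := by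
  simp [pPrj]

theorem prj_self (n : ℤ) (a : V) (ha : a ∈ S.gr n) : S.prj n a = a := by
  rw [prj, sfGlue_apply _ _ _ n a ha]; simp

theorem prj_ne (n m : ℤ) (h : m ≠ n) (a : V) (ha : a ∈ S.gr m) : S.prj n a = 0 := by
  rw [prj, sfGlue_apply _ _ _ m a ha]; simp [h]

theorem pGr_internal : DirectSum.IsInternal S.pGr := by
  apply sf_internal S.pGr S.pPrj
  · intro n
    refine S.gr_ind n ?_ ?_ ?_ ?_ ?_
    · simp
    · intro x y hx hy; rw [map_add, hx, hy]
    · intro c x hx; rw [map_smul, hx]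
    · intro m a ha; rw [pPrj_l, S.prj_self n a ha]
    · intro m a ha; rw [pPrj_r, S.prj_self _ a ha]
  · intro n k hk
    refine S.gr_ind k ?_ ?_ ?_ ?_ ?_
    · simp
    · intro x y hx hy; rw [map_add, hx, hy, add_zero]
    · intro c x hx; rw [map_smul, hx, smul_zero]
    · intro m a ha; rw [pPrj_l, S.prj_ne n k hk a ha, map_zero]
    · intro m a ha; rw [pPrj_r, S.prj_ne _ _ (by omega) a ha, map_zero]
  · rw [eq_top_iff]
    intro x ht
    clear ht
    induction x using @path_ind K _ V _ _ with
    | h0 => exact zero_mem _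
    | hadd x y hx hy => exact add_mem hx hy
    | hl m a =>
      induction a using sf_hom_induction S.gr S.internal with
      | h0 => rw [map_zero]; exact zero_mem _
      | hadd x y hx hy => rw [map_add]; exact add_mem hx hy
      | hh n x hx => exact Submodule.mem_iSup_of_mem n (S.mem_l n m x hx)
    | hr m a =>
      induction a using sf_hom_induction S.gr S.internal with
      | h0 => rw [map_zero]; exact zero_mem _
      | hadd x y hx hy => rw [map_add]; exact add_mem hx hy
      | hh n x hx =>
        exact Submodule.mem_iSup_of_mem (n + 1) (S.mem_r (n + 1) m x (by simpa using hx))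

theorem pD_deg (n : ℤ) : ∀ x ∈ S.pGr n, S.pD x ∈ S.pGr (n + 1) := by
  refine S.gr_ind n ?_ ?_ ?_ ?_ ?_
  · simp
  · intro x y hx hy; rw [map_add]; exact add_mem hx hy
  · intro c x hx; rw [map_smul]; exact Submodule.smul_mem _ _ hx
  · intro m a ha; rw [pD_inl]
    exact add_mem (S.mem_l _ _ _ (S.d_deg _ _ ha))
      (Submodule.smul_mem _ _ (S.mem_r _ _ _ (by simpa using ha)))
  · intro m a ha; rw [pD_inr]
    refine neg_mem (S.mem_r _ _ _ ?_)
    convert S.d_deg _ _ ha using 2; ring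

theorem pD_sq (x : Path V) : S.pD (S.pD x) = 0 := by
  induction x using @path_ind K _ V _ _ with
  | h0 => simp
  | hadd x y hx hy => rw [map_add, map_add, hx, hy, add_zero]
  | hl m a => rw [pD_inl, map_add, map_smul, pD_inl, pD_inr, S.d_sq, map_zero]; simp
  | hr m a => rw [pD_inr, map_neg, pD_inr, S.d_sq, map_zero]; simp

theorem pB_deg (i j : ℤ) (x : Path V) (hx : x ∈ S.pGr i) (y : Path V) (hy : y ∈ S.pGr j) :
    S.pB x y ∈ S.pGr (i + j) := by
  revert y
  refine S.gr_ind j ?_ ?_ ?_ ?_ ?_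
  · simp
  · intro y z hx hy; rw [map_add]; exact add_mem hx hy
  · intro c x hx; rw [map_smul]; exact Submodule.smul_mem _ _ hx
  · intro n b hb
    revert x
    refine S.gr_ind i ?_ ?_ ?_ ?_ ?_
    · simp
    · intro x y hx hy; rw [map_add, LinearMap.add_apply]; exact add_mem hx hy
    · intro c x hx; rw [map_smul]; exact Submodule.smul_mem _ _ hx
    · intro m a ha; rw [pB_ll]
      exact add_mem (S.mem_l _ _ _ (S.b_deg _ _ _ ha _ hb)) (S.mem_r _ _ _ (S.r_deg _ _ _ ha _ hb))
    · intro m a ha; rw [pB_rl]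
      refine (S.mem_r _ _ _ ?_)
      convert S.b_deg _ _ _ ha _ hb using 2; ring
  · intro n b hb
    revert x
    refine S.gr_ind i ?_ ?_ ?_ ?_ ?_
    · simp
    · intro x y hx hy; rw [map_add, LinearMap.add_apply]; exact add_mem hx hy
    · intro c x hx; rw [map_smul]; exact Submodule.smul_mem _ _ hx
    · intro m a ha; rw [pB_lr]
      refine (S.mem_r _ _ _ ?_)
      convert S.b_deg _ _ _ (S.s_deg _ _ ha) _ hb using 2; ring
    · intro m a ha; rw [pB_rr]; exact zero_mem _

theorem pB_anti (i j : ℤ) (x : Path V) (hx : x ∈ S.pGr i) (y : Path V) (hy : y ∈ S.pGr j) :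
    S.pB x y = -(((i * j).negOnePow : ℤ) • S.pB y x) := by
  revert y
  refine S.gr_ind j ?_ ?_ ?_ ?_ ?_
  · simp
  · intro y z hx hy; rw [map_add, map_add, LinearMap.add_apply, hx, hy]; module
  · intro c y hx; rw [map_smul, map_smul, LinearMap.smul_apply, hx]; module
  · intro n b hb
    revert x
    refine S.gr_ind i ?_ ?_ ?_ ?_ ?_
    · simp
    · intro y z hx hy; rw [map_add, map_add, LinearMap.add_apply, hx, hy]; module
    · intro c y hx; rw [map_smul, map_smul, LinearMap.smul_apply, hx]; module
    · intro m a ha; rw [pB_ll, pB_ll, S.b_anti i j a ha b hb, S.r_anti i j a ha b hb, add_comm n m]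
      simp only [map_neg, map_zsmul]; module
    · intro m a ha; rw [pB_rl, pB_lr, S.b_anti _ j a ha b hb, S.s_app j b hb, add_comm n m]
      simp only [map_neg, map_zsmul, LinearMap.smul_apply]
      simp only [sf_nop, Int.even_add, Int.even_mul, Int.not_even_one, Int.even_sub]
      by_cases hi : Even i <;> by_cases hj : Even j <;> simp [hi, hj]
  · intro n b hb
    revert x
    refine S.gr_ind i ?_ ?_ ?_ ?_ ?_
    · simp
    · intro y z hx hy; rw [map_add, map_add, LinearMap.add_apply, hx, hy]; module
    · intro c y hx; rw [map_smul, map_smul, LinearMap.smul_apply, hx]; module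
    · intro m a ha; rw [pB_rl, pB_lr, S.s_app i a ha, map_zsmul, LinearMap.smul_apply,
        S.b_anti i _ a ha b hb, add_comm n m]
      simp only [map_neg, map_zsmul, LinearMap.smul_apply]
      simp only [sf_nop, Int.even_add, Int.even_mul, Int.not_even_one, Int.even_sub]
      by_cases hi : Even i <;> by_cases hj : Even j <;> simp [hi, hj]
    · intro m a ha; rw [pB_rr, pB_rr]; simp

theorem cast_sub (m : ℕ) (n : ℕ) (a : V) :
    (m : K) • sl K (.inr (m - 1 + n + 1)) a = (m : K) • sl K (.inr (m + n)) a := by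
  cases m with
  | zero => simp
  | succ m => rw [show m + 1 - 1 + n + 1 = m + 1 + n by omega]

theorem cast_sub' (m : ℕ) (n : ℕ) (a : V) :
    (m : K) • sl K (.inr (n + (m - 1) + 1)) a = (m : K) • sl K (.inr (n + m)) a := by
  cases m with
  | zero => simp
  | succ m => rw [show n + (m + 1 - 1) + 1 = n + (m + 1) by omega]

theorem pB_leib (i : ℤ) (x : Path V) (hx : x ∈ S.pGr i) (y : Path V) :
    S.pD (S.pB x y) = S.pB (S.pD x) y + (i.negOnePow : ℤ) • S.pB x (S.pD y) := by
  induction y using @path_ind K _ V _ _ with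
  | h0 => simp
  | hadd y z hy hz => simp only [map_add, hy, hz]; module
  | hl n b =>
    revert x
    refine S.gr_ind i ?_ ?_ ?_ ?_ ?_
    · simp
    · intro y z hy hz; simp only [map_add, LinearMap.add_apply, hy, hz]; module
    · intro c y hy; simp only [map_smul, LinearMap.smul_apply, hy]; module
    · intro m a ha
      simp only [pB_ll, pD_inl, pB_lr, pB_rl, pD_inr, map_add, map_smul, LinearMap.add_apply,
        LinearMap.smul_apply, cast_sub, cast_sub', S.b_leib i a ha, S.d_r i a ha,
        map_zsmul, map_sub, Nat.add_sub_cancel, Nat.cast_add, Nat.cast_one]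
      simp only [S.s_app i a ha, map_zsmul, LinearMap.smul_apply]
      simp only [sf_nop]
      by_cases hi : Even i <;> simp only [hi, if_true, if_false] <;> module
    · intro m a ha
      simp only [pB_ll, pD_inl, pB_lr, pB_rl, pB_rr, pD_inr, map_add, map_smul, LinearMap.add_apply,
        LinearMap.smul_apply, LinearMap.neg_apply, map_neg, S.b_leib _ a ha, map_zsmul]
      simp only [sf_nop, Int.even_sub, Int.not_even_one]
      by_cases hi : Even i <;> simp only [hi, if_true, if_false] <;> simp <;> abel
  | hr n b =>
    revert x
    refine S.gr_ind i ?_ ?_ ?_ ?_ ?_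
    · simp
    · intro y z hy hz; simp only [map_add, LinearMap.add_apply, hy, hz]; module
    · intro c y hy; simp only [map_smul, LinearMap.smul_apply, hy]; module
    · intro m a ha
      simp only [pB_ll, pD_inl, pB_lr, pB_rl, pB_rr, pD_inr, map_add, map_smul, LinearMap.add_apply,
        LinearMap.smul_apply, LinearMap.neg_apply, map_neg, S.s_app i a ha,
        S.s_app _ _ (S.d_deg _ _ ha), S.b_leib _ a ha, map_zsmul]
      simp only [sf_nop, Int.even_sub, Int.not_even_one, Int.even_add]
      by_cases hi : Even i <;> simp [hi] <;> abel
    · intro m a ha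
      simp only [pB_rr, pD_inr, map_neg, LinearMap.neg_apply, map_zero]; simp

theorem pB_jac (i j : ℤ) (x : Path V) (hx : x ∈ S.pGr i) (y : Path V) (hy : y ∈ S.pGr j)
    (z : Path V) :
    S.pB x (S.pB y z) = S.pB (S.pB x y) z + ((i * j).negOnePow : ℤ) • S.pB y (S.pB x z) := by
  induction z using @path_ind K _ V _ _ with
  | h0 => simp
  | hadd z z' hz hz' => simp only [map_add, hz, hz']; module
  | hl p c =>
    revert y
    refine S.gr_ind j ?_ ?_ ?_ ?_ ?_
    · simp
    · intro y y' hy hy'; simp only [map_add, LinearMap.add_apply, hy, hy']; module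
    · intro c y hy; simp only [map_smul, LinearMap.smul_apply, hy]; module
    · intro n b hb
      revert x
      refine S.gr_ind i ?_ ?_ ?_ ?_ ?_
      · simp
      · intro y z hy hz; simp only [map_add, LinearMap.add_apply, hy, hz]; module
      · intro c y hy; simp only [map_smul, LinearMap.smul_apply, hy]; module
      · intro m a ha
        have hJ := congrArg (sl K (.inl (m + n + p + 2))) (S.b_jac i j a ha b hb c)
        have hM := congrArg (sl K (.inr (m + n + p + 1))) (S.mj i j a ha b hb c)
        simp only [pB_ll, pB_lr, pB_rl, map_add, LinearMap.add_apply, S.s_app i a ha,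
          S.s_app j b hb, map_zsmul, LinearMap.smul_apply] at hJ hM ⊢
        rw [show m + (n + p + 1) + 1 = m + n + p + 2 by ring,
          show m + n + 1 + p + 1 = m + n + p + 2 by ring,
          show n + (m + p + 1) + 1 = m + n + p + 2 by ring,
          show m + (n + p + 1) = m + n + p + 1 by ring,
          show m + n + 1 + p = m + n + p + 1 by ring,
          show n + (m + p + 1) = m + n + p + 1 by ring,
          show m + (n + p) + 1 = m + n + p + 1 by ring,
          show n + (m + p) + 1 = m + n + p + 1 by ring]
        linear_combination (norm := module) hJ + hM
      · intro m a ha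
        have hJ := congrArg (sl K (.inr (m + n + p + 2))) (S.b_jac _ j a ha b hb c)
        simp only [pB_ll, pB_lr, pB_rl, pB_rr, map_add, LinearMap.add_apply,
          S.s_app j b hb, map_zsmul, LinearMap.smul_apply] at hJ ⊢
        rw [show m + (n + p + 1) + 1 = m + n + p + 2 by ring,
          show m + n + 1 + p + 1 = m + n + p + 2 by ring,
          show n + (m + p + 1) + 1 = m + n + p + 2 by ring, hJ]
        simp only [sf_nop, Int.even_mul, Int.not_even_one, Int.even_sub]
        by_cases hi : Even i <;> by_cases hj : Even j <;> simp [hi, hj]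
    · intro n b hb
      revert x
      refine S.gr_ind i ?_ ?_ ?_ ?_ ?_
      · simp
      · intro y z hy hz; simp only [map_add, LinearMap.add_apply, hy, hz]; module
      · intro c y hy; simp only [map_smul, LinearMap.smul_apply, hy]; module
      · intro m a ha
        have hJ := congrArg (sl K (.inr (m + n + p + 2))) (S.b_jac i _ a ha b hb c)
        simp only [pB_ll, pB_lr, pB_rl, pB_rr, map_add, LinearMap.add_apply, S.s_app i a ha,
          map_zsmul, LinearMap.smul_apply] at hJ ⊢
        rw [show m + (n + p + 1) + 1 = m + n + p + 2 by ring,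
          show m + n + 1 + p + 1 = m + n + p + 2 by ring,
          show n + (m + p + 1) + 1 = m + n + p + 2 by ring, hJ]
        simp only [sf_nop, Int.even_mul, Int.not_even_one, Int.even_sub]
        by_cases hi : Even i <;> by_cases hj : Even j <;> simp [hi, hj]
      · intro m a ha
        simp [pB_ll, pB_lr, pB_rl, pB_rr, -Finsupp.lsingle_apply]
  | hr p c =>
    revert y
    refine S.gr_ind j ?_ ?_ ?_ ?_ ?_
    · simp
    · intro y y' hy hy'; simp only [map_add, LinearMap.add_apply, hy, hy']; module
    · intro c y hy; simp only [map_smul, LinearMap.smul_apply, hy]; module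
    · intro n b hb
      revert x
      refine S.gr_ind i ?_ ?_ ?_ ?_ ?_
      · simp
      · intro y z hy hz; simp only [map_add, LinearMap.add_apply, hy, hz]; module
      · intro c y hy; simp only [map_smul, LinearMap.smul_apply, hy]; module
      · intro m a ha
        have hJ := congrArg (sl K (.inr (m + n + p + 2))) (S.b_jac i j a ha b hb c)
        simp only [pB_ll, pB_lr, pB_rl, pB_rr, map_add, LinearMap.add_apply, S.s_app i a ha,
          S.s_app j b hb, S.s_app _ _ (S.b_deg _ _ _ ha _ hb),
          map_zsmul, LinearMap.smul_apply] at hJ ⊢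
        rw [show m + (n + p + 1) + 1 = m + n + p + 2 by ring,
          show m + n + 1 + p + 1 = m + n + p + 2 by ring,
          show n + (m + p + 1) + 1 = m + n + p + 2 by ring, hJ]
        simp only [sf_nop, Int.even_mul, Int.not_even_one, Int.even_add]
        by_cases hi : Even i <;> by_cases hj : Even j <;> simp [hi, hj]
      · intro m a ha
        simp [pB_ll, pB_lr, pB_rl, pB_rr, -Finsupp.lsingle_apply]
    · intro n b hb
      revert x
      refine S.gr_ind i ?_ ?_ ?_ ?_ ?_
      · simp
      · intro y z hy hz; simp only [map_add, LinearMap.add_apply, hy, hz]; module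
      · intro c y hy; simp only [map_smul, LinearMap.smul_apply, hy]; module
      · intro m a ha
        simp [pB_ll, pB_lr, pB_rl, pB_rr, -Finsupp.lsingle_apply]
      · intro m a ha
        simp [pB_ll, pB_lr, pB_rl, pB_rr, -Finsupp.lsingle_apply]

noncomputable def pathStr : DGLAon K (Path V) where
  grading := S.pGr
  internal := S.pGr_internal
  d := S.pD
  d_deg := S.pD_deg
  d_sq := LinearMap.ext S.pD_sq
  bracket := S.pB
  bracket_deg := fun i j x hx y hy => S.pB_deg i j x hx y hy
  antisymm := fun i j x hx y hy => S.pB_anti i j x hx y hy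
  jacobi := fun i j x hx y hy z => S.pB_jac i j x hx y hy z
  leibniz := fun i x hx y => S.pB_leib i x hx y

noncomputable def str : DGLAon K V where
  grading := S.gr
  internal := S.internal
  d := S.d
  d_deg := S.d_deg
  d_sq := LinearMap.ext S.d_sq
  bracket := S.b
  bracket_deg := fun i j x hx y hy => S.b_deg i j x hx y hy
  antisymm := fun i j x hx y hy => S.b_anti i j x hx y hy
  jacobi := fun i j x hx y hy z => S.b_jac i j x hx y hy z
  leibniz := fun i x hx y => S.b_leib i x hx y

noncomputable def abStr : DGLAon K V where
  grading := S.gr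
  internal := S.internal
  d := S.d
  d_deg := S.d_deg
  d_sq := LinearMap.ext S.d_sq
  bracket := 0
  bracket_deg := by simp
  antisymm := by simp
  jacobi := by simp
  leibniz := by simp

noncomputable def ev0 : Path V →ₗ[K] V :=
  Finsupp.lsum K (fun i => match i with
    | Sum.inl m => if m = 0 then LinearMap.id else 0
    | Sum.inr _ => 0)

noncomputable def ev1 : Path V →ₗ[K] V :=
  Finsupp.lsum K (fun i => match i with
    | Sum.inl _ => LinearMap.id
    | Sum.inr _ => 0)

theorem ev0_l (m : ℕ) (a : V) : ev0 (K := K) (sl K (.inl m) a) = if m = 0 then a else 0 := by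
  by_cases h : m = 0 <;> simp [ev0, h]
theorem ev0_r (m : ℕ) (a : V) : ev0 (K := K) (sl K (.inr m) a) = 0 := by simp [ev0]
theorem ev1_l (m : ℕ) (a : V) : ev1 (K := K) (sl K (.inl m) a) = a := by simp [ev1]
theorem ev1_r (m : ℕ) (a : V) : ev1 (K := K) (sl K (.inr m) a) = 0 := by simp [ev1]

noncomputable def ht0 : Path V →ₗ[K] Path V :=
  Finsupp.lsum K (fun i => match i with
    | Sum.inl _ => 0
    | Sum.inr m => ((m : K) + 1)⁻¹ • sl K (.inl (m + 1)))

noncomputable def ht1 : Path V →ₗ[K] Path V :=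
  Finsupp.lsum K (fun i => match i with
    | Sum.inl _ => 0
    | Sum.inr m => ((m : K) + 1)⁻¹ • (sl K (.inl (m + 1)) - sl K (.inl 0)))

theorem ht0_l (m : ℕ) (a : V) : ht0 (K := K) (sl K (.inl m) a) = 0 := by simp [ht0]
theorem ht0_r (m : ℕ) (a : V) :
    ht0 (K := K) (sl K (.inr m) a) = ((m : K) + 1)⁻¹ • sl K (.inl (m + 1)) a := by simp [ht0]
theorem ht1_l (m : ℕ) (a : V) : ht1 (K := K) (sl K (.inl m) a) = 0 := by simp [ht1]
theorem ht1_r (m : ℕ) (a : V) : ht1 (K := K) (sl K (.inr m) a)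
    = ((m : K) + 1)⁻¹ • (sl K (.inl (m + 1)) a - sl K (.inl 0) a) := by simp [ht1]

theorem qi_of_homotopy {G H : DGLA K} (φ : DGLAHom K G H) (j : H.L →ₗ[K] G.L) (h : G.L →ₗ[K] G.L)
    (hj : ∀ x, j (H.str.d x) = G.str.d (j x)) (hφ : ∀ x, φ.f (j x) = x)
    (hh : ∀ x, x = j (φ.f x) + G.str.d (h x) + h (G.str.d x)) : IsQuasiIso K φ := by
  refine ⟨?_, ?_⟩
  · rintro x hx ⟨z, hz⟩
    refine ⟨j z + h x, ?_⟩
    conv_lhs => rw [hh x, hx, hz, hj, map_zero, add_zero]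
    rw [map_add]
  · intro y hy
    refine ⟨j y, 0, ?_, ?_⟩
    · rw [← hj, hy, map_zero]
    · rw [hφ, map_zero, add_zero]

noncomputable def hom0 : DGLAHom K ⟨Path V, S.pathStr⟩ ⟨V, S.abStr⟩ where
  f := ev0
  compat_d := by
    intro x
    change ev0 (K := K) (S.pD x) = S.d (ev0 (K := K) x)
    induction x using @path_ind K _ V _ _ with
    | h0 => simp
    | hadd x y hx hy => simp only [map_add, hx, hy]
    | hl m a => rw [pD_inl, map_add, map_smul, ev0_l, ev0_l, ev0_r]; split_ifs <;> simp
    | hr m a => rw [pD_inr, map_neg, ev0_r, ev0_r]; simp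
  compat_br := by
    intro x y
    change ev0 (K := K) (S.pB x y) = 0
    induction x using @path_ind K _ V _ _ with
    | h0 => simp
    | hadd x y hx hy => simp only [map_add, hx, hy, LinearMap.add_apply, add_zero]
    | hl m a =>
      induction y using @path_ind K _ V _ _ with
      | h0 => simp
      | hadd x y hx hy => simp only [map_add, hx, hy, LinearMap.add_apply, add_zero]
      | hl n b => rw [pB_ll, map_add, ev0_l, ev0_r]; simp
      | hr n b => rw [pB_lr, ev0_r]
    | hr m a =>
      induction y using @path_ind K _ V _ _ with
      | h0 => simp
      | hadd x y hx hy => simp only [map_add, hx, hy, LinearMap.add_apply, add_zero]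
      | hl n b => rw [pB_rl, ev0_r]
      | hr n b => rw [pB_rr, map_zero]
  compat_gr := by
    intro i
    change ∀ x ∈ S.pGr i, ev0 (K := K) x ∈ S.gr i
    refine S.gr_ind i ?_ ?_ ?_ ?_ ?_
    · simp
    · intro x y hx hy; rw [map_add]; exact add_mem hx hy
    · intro c x hx; rw [map_smul]; exact Submodule.smul_mem _ _ hx
    · intro m a ha; rw [ev0_l]; split_ifs
      · exact ha
      · exact zero_mem _
    · intro m a ha; rw [ev0_r]; exact zero_mem _

noncomputable def hom1 : DGLAHom K ⟨Path V, S.pathStr⟩ ⟨V, S.str⟩ where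
  f := ev1
  compat_d := by
    intro x
    change ev1 (K := K) (S.pD x) = S.d (ev1 (K := K) x)
    induction x using @path_ind K _ V _ _ with
    | h0 => simp
    | hadd x y hx hy => simp only [map_add, hx, hy]
    | hl m a => rw [pD_inl, map_add, map_smul, ev1_l, ev1_l, ev1_r]; simp
    | hr m a => rw [pD_inr, map_neg, ev1_r, ev1_r]; simp
  compat_br := by
    intro x y
    change ev1 (K := K) (S.pB x y) = S.b (ev1 (K := K) x) (ev1 (K := K) y)
    induction x using @path_ind K _ V _ _ with
    | h0 => simp
    | hadd x y hx hy => simp only [map_add, hx, hy, LinearMap.add_apply]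
    | hl m a =>
      induction y using @path_ind K _ V _ _ with
      | h0 => simp
      | hadd x y hx hy => simp only [map_add, hx, hy]
      | hl n b => rw [pB_ll, map_add, ev1_l, ev1_r, ev1_l, ev1_l, add_zero]
      | hr n b => rw [pB_lr, ev1_r, ev1_r, map_zero]
    | hr m a =>
      induction y using @path_ind K _ V _ _ with
      | h0 => simp
      | hadd x y hx hy => simp only [map_add, hx, hy]
      | hl n b => rw [pB_rl, ev1_r, ev1_r, map_zero, LinearMap.zero_apply]
      | hr n b => rw [pB_rr, map_zero, ev1_r, map_zero, LinearMap.zero_apply]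
  compat_gr := by
    intro i
    change ∀ x ∈ S.pGr i, ev1 (K := K) x ∈ S.gr i
    refine S.gr_ind i ?_ ?_ ?_ ?_ ?_
    · simp
    · intro x y hx hy; rw [map_add]; exact add_mem hx hy
    · intro c x hx; rw [map_smul]; exact Submodule.smul_mem _ _ hx
    · intro m a ha; rw [ev1_l]; exact ha
    · intro m a ha; rw [ev1_r]; exact zero_mem _

theorem qi0 : IsQuasiIso K S.hom0 := by
  refine qi_of_homotopy S.hom0 (sl K (.inl 0)) ht0 ?_ ?_ ?_
  · intro x
    change sl K (.inl 0) (S.d x) = S.pD (sl K (.inl 0) x)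
    rw [pD_inl]; simp
  · intro x
    change ev0 (K := K) (sl K (.inl 0) x) = x
    rw [ev0_l]; simp
  · intro x
    change x = sl K (.inl 0) (ev0 (K := K) x) + S.pD (ht0 (K := K) x) + ht0 (K := K) (S.pD x)
    induction x using @path_ind K _ V _ _ with
    | h0 => simp
    | hadd x y hx hy => conv_lhs => rw [hx, hy]
                        simp only [map_add]; abel
    | hl m a =>
      rw [pD_inl, ev0_l, ht0_l, map_add, ht0_l, map_smul, ht0_r]
      rcases m with _ | m
      · simp
      · have : (m : K) + 1 ≠ 0 := by exact_mod_cast Nat.succ_ne_zero m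
        simp [smul_smul, this]
    | hr m a =>
      have : (m : K) + 1 ≠ 0 := by exact_mod_cast Nat.succ_ne_zero m
      rw [pD_inr, ev0_r, ht0_r, map_smul, map_neg, pD_inl, ht0_r]
      simp [smul_smul, this]

theorem qi1 : IsQuasiIso K S.hom1 := by
  refine qi_of_homotopy S.hom1 (sl K (.inl 0)) ht1 ?_ ?_ ?_
  · intro x
    change sl K (.inl 0) (S.d x) = S.pD (sl K (.inl 0) x)
    rw [pD_inl]; simp
  · intro x
    change ev1 (K := K) (sl K (.inl 0) x) = x
    rw [ev1_l]
  · intro x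
    change x = sl K (.inl 0) (ev1 (K := K) x) + S.pD (ht1 (K := K) x) + ht1 (K := K) (S.pD x)
    induction x using @path_ind K _ V _ _ with
    | h0 => simp
    | hadd x y hx hy => conv_lhs => rw [hx, hy]
                        simp only [map_add]; abel
    | hl m a =>
      rw [pD_inl, ev1_l, ht1_l, map_add, ht1_l, map_smul, ht1_r]
      rcases m with _ | m
      · simp
      · have : (m : K) + 1 ≠ 0 := by exact_mod_cast Nat.succ_ne_zero m
        simp [smul_smul, this]
    | hr m a =>
      have : (m : K) + 1 ≠ 0 := by exact_mod_cast Nat.succ_ne_zero m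
      rw [pD_inr, ev1_r, ht1_r, map_smul, map_neg, map_sub, pD_inl, pD_inl, ht1_r]
      simp [smul_smul, this, smul_sub, smul_add]

theorem homotopyAbelian : HomotopyAbelian K ⟨V, S.str⟩ := by
  refine ⟨⟨V, S.abStr⟩, fun x y => rfl, ?_⟩
  exact Relation.EqvGen.trans _ _ _
    (Relation.EqvGen.symm _ _ (Relation.EqvGen.rel _ _ ⟨S.hom1, S.qi1⟩))
    (Relation.EqvGen.rel _ _ ⟨S.hom0, S.qi0⟩)

end SfData


namespace SfAlg
variable {K : Type} [Field K] {A : Type} [Ring A] [Algebra K A]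

/-- left multiplication as an endomorphism -/
noncomputable abbrev LL (K : Type) [Field K] {A : Type} [Ring A] [Algebra K A] (a : A) :
    Module.End K A := LinearMap.mulLeft K a

theorem LL_add (a b : A) : LL K (a + b) = LL K a + LL K b := by
  ext x; simp [add_mul]
theorem LL_sub (a b : A) : LL K (a - b) = LL K a - LL K b := by
  ext x; simp [sub_mul]
theorem LL_neg (a : A) : LL K (-a) = 0 - LL K a := by
  ext x; simp
theorem LL_zsmul (n : ℤ) (a : A) : LL K (n • a) = n • LL K a := by
  ext x
  change (n • a) * x = n • (a * x)
  rw [smul_mul_assoc]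
theorem LL_inj (a b : A) (h : LL K a = LL K b) : a = b := by
  have := congrArg (fun f : Module.End K A => f 1) h
  simpa using this

/-- the operator `R` -/
def RA (f : A →ₗ[K] A) (x y : A) : A := f (x * y) - f x * y - x * f y

theorem gcomm_apply (r i : ℤ) (f : A →ₗ[K] A) (a x : A) :
    gcomm r i f a x = f (a * x) - ((r * i).negOnePow : ℤ) • (a * f x) := by
  rfl

theorem gcomm_eq (r i : ℤ) (f : Module.End K A) (a : A) :
    (gcomm r i f a : Module.End K A) = f * LL K a - ((r * i).negOnePow : ℤ) • (LL K a * f) := rfl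

theorem zE (n : ℤ) (f : Module.End K A) :
    ((n.negOnePow : ℤˣ) : ℤ) • f = if Even n then f else 0 - f := by
  rw [sf_nop]
  split_ifs
  · ext x
    change (1 : ℤ) • f x = f x
    rw [one_smul]
  · ext x
    change (-1 : ℤ) • f x = 0 - f x
    rw [neg_smul, one_smul, zero_sub]

theorem RA_deg (𝒜 : ℤ → Submodule K A) (hA : IsGradedComm 𝒜) (f : A →ₗ[K] A) (r : ℤ)
    (hf : HasDeg 𝒜 f r) (p q : ℤ) (a b : A) (ha : a ∈ 𝒜 p) (hb : b ∈ 𝒜 q) :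
    RA f a b ∈ 𝒜 (p + q + r) := by
  refine sub_mem (sub_mem (hf _ _ (hA.2.2.1 _ _ _ ha _ hb)) ?_) ?_
  · convert hA.2.2.1 _ _ _ (hf _ _ ha) _ hb using 2; ring
  · convert hA.2.2.1 _ _ _ ha _ (hf _ _ hb) using 2; ring

theorem RA_symm (𝒜 : ℤ → Submodule K A) (hA : IsGradedComm 𝒜) (f : A →ₗ[K] A) (k : ℤ)
    (hf : HasDeg 𝒜 f (-(2 * k))) (p q : ℤ) (a b : A) (ha : a ∈ 𝒜 p) (hb : b ∈ 𝒜 q) :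
    RA f a b = ((p * q).negOnePow : ℤ) • RA f b a := by
  have h1 := hA.2.2.2 _ _ _ ha _ hb
  have h2 := hA.2.2.2 _ _ _ (hf _ _ ha) _ hb
  have h3 := hA.2.2.2 _ _ _ ha _ (hf _ _ hb)
  unfold RA
  rw [h1, h2, h3, map_zsmul]
  simp only [sf_nop, Int.even_add, Int.even_mul, even_neg, even_two, true_or, iff_true]
  by_cases hp : Even p <;> by_cases hq : Even q <;> simp [hp, hq] <;> abel

theorem R_op (𝒜 : ℤ → Submodule K A) (hA : IsGradedComm 𝒜) (k : ℤ) (f : Module.End K A)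
    (hf : IsQuasiBV 𝒜 (-(2 * k)) f) (p q : ℤ) (a b : A) (ha : a ∈ 𝒜 p) (hb : b ∈ 𝒜 q) :
    LL K (RA f a b) = f * LL K a * LL K b - LL K a * f * LL K b
      - ((p * q).negOnePow : ℤ) • (LL K b * f * LL K a - LL K b * LL K a * f) := by
  obtain ⟨hdeg, hdiff, h1⟩ := hf
  have hG := hdiff p a ha q b hb
  set G : Module.End K A := gcomm (-(2 * k) + p) q (gcomm (-(2 * k)) p f a) b with hGdef
  have hGe : G = f * LL K a * LL K b - LL K a * f * LL K b
      - ((p * q).negOnePow : ℤ) • (LL K b * f * LL K a - LL K b * LL K a * f) := by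
    rw [hGdef, gcomm_eq, gcomm_eq]
    simp only [zE, Int.even_add, Int.even_mul, even_neg, even_two, true_or, true_iff, if_true]
    by_cases hp : Even p <;> by_cases hq : Even q <;> simp only [hp, hq, iff_true, iff_false, or_true, true_or, or_self, if_true, if_false] <;>
      (simp only [sub_mul, mul_sub, add_mul, mul_add, zero_mul, mul_zero, mul_assoc]; try abel)
  have hG1 : G 1 = RA f a b := by
    have h2 := hA.2.2.2 _ _ _ (hdeg _ _ ha) _ hb
    rw [hGdef, gcomm_apply, gcomm_apply, gcomm_apply, RA, h1, h2]
    simp only [sf_nop, Int.even_add, Int.even_mul, even_neg, even_two, true_or, true_iff,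
      mul_one, iff_true]
    by_cases hp : Even p <;> by_cases hq : Even q <;> simp [hp, hq] <;> abel
  rw [← hGe]
  ext x
  induction x using sf_hom_induction 𝒜 hA.1 with
  | h0 => simp
  | hadd x y hx hy => rw [map_add, map_add, hx, hy]
  | hh n x hx =>
    have h3 := congrArg (fun g : A →ₗ[K] A => g 1) (hG n x hx)
    simp only [gcomm_apply, mul_one, LinearMap.zero_apply] at h3
    have h4 : G 1 ∈ 𝒜 (p + q + -(2 * k)) := hG1 ▸ RA_deg 𝒜 hA f _ hdeg p q a b ha hb
    rw [sub_eq_zero.mp h3, LinearMap.mulLeft_apply, ← hG1, hA.2.2.2 _ _ _ h4 _ hx]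
    simp only [sf_nop, Int.even_add, Int.even_mul, even_neg, even_two, true_or, true_iff,
      mul_one, iff_true]

theorem d_op (𝒜 : ℤ → Submodule K A) (d : Module.End K A) (hder : IsGDer 𝒜 1 d) (p : ℤ) (a : A)
    (ha : a ∈ 𝒜 p) : LL K (d a) = d * LL K a - (p.negOnePow : ℤ) • (LL K a * d) := by
  ext x
  have := hder p a ha x
  rw [one_mul] at this
  change d a * x = d (a * x) - (p.negOnePow : ℤ) • (a * d x)
  rw [this]; abel

theorem koszul_eq (𝒜 : ℤ → Submodule K A) (d : A →ₗ[K] A) (hder : IsGDer 𝒜 1 d)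
    (k : ℤ) (bi : A →ₗ[K] A) (hbi : HasDeg 𝒜 bi (-(2 * k)))
    (l : A →ₗ[K] A) (hl : l = bi ∘ₗ d - d ∘ₗ bi) (p : ℤ) (a : A) (ha : a ∈ 𝒜 p) (b : A) :
    koszulBr l p a b = -((p.negOnePow : ℤ) • d (RA bi a b)) + (p.negOnePow : ℤ) • RA bi (d a) b
      + RA bi a (d b) := by
  have h1 := hder p a ha b
  have h2 := hder _ _ (hbi _ _ ha) b
  have h3 := hder p a ha (bi b)
  subst hl
  simp only [koszulBr, RA, LinearMap.sub_apply, LinearMap.comp_apply, map_sub, h1, h2, h3, map_add,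
    map_zsmul, one_mul]
  simp only [sf_nop, Int.even_add, Int.even_mul, even_neg, even_two, true_or, iff_true]
  by_cases hp : Even p <;> simp [hp] <;> noncomm_ring

theorem Q_op (𝒜 : ℤ → Submodule K A) (hA : IsGradedComm 𝒜)
    (d : Module.End K A) (hddeg : HasDeg 𝒜 d 1) (hder : IsGDer 𝒜 1 d)
    (k : ℤ) (bi : Module.End K A) (hbi : IsQuasiBV 𝒜 (-(2 * k)) bi)
    (l : Module.End K A) (hl : l = bi * d - d * bi) (p q : ℤ) (a b : A)
    (ha : a ∈ 𝒜 p) (hb : b ∈ 𝒜 q) :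
    LL K (koszulBr l p a b) = (p.negOnePow : ℤ) • (l * LL K a * LL K b) - LL K a * l * LL K b
      - (((p + 1) * q).negOnePow : ℤ) • ((p.negOnePow : ℤ) • (LL K b * l * LL K a)
        - LL K b * LL K a * l) := by
  rw [koszul_eq 𝒜 d hder k bi hbi.1 l hl p a ha, LL_add, LL_add, LL_neg, LL_zsmul, LL_zsmul,
    d_op 𝒜 d hder _ _ (RA_deg 𝒜 hA bi _ hbi.1 p q a b ha hb),
    R_op 𝒜 hA k bi hbi p q a b ha hb, R_op 𝒜 hA k bi hbi _ q _ b (hddeg _ _ ha) hb,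
    R_op 𝒜 hA k bi hbi p _ a _ ha (hddeg _ _ hb), d_op 𝒜 d hder p a ha, d_op 𝒜 d hder q b hb, hl]
  generalize LL K a = a
  generalize LL K b = b
  simp only [zE, Int.even_add, Int.even_mul, even_neg, even_two, true_or, iff_true,
    Int.not_even_one]
  by_cases hp : Even p <;> by_cases hq : Even q <;>
    simp only [hp, hq, iff_true, iff_false, or_true, true_or, or_self, if_true, if_false,
      not_true_eq_false, not_false_eq_true, iff_self, true_iff, false_iff,
      false_or, or_false] <;>
    (simp only [sub_mul, mul_sub, add_mul, mul_add, zero_mul, mul_zero, mul_assoc]; abel)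

theorem koszul_deg (𝒜 : ℤ → Submodule K A) (hA : IsGradedComm 𝒜)
    (l : A →ₗ[K] A) (r : ℤ) (hl : HasDeg 𝒜 l r) (p q : ℤ) (a b : A)
    (ha : a ∈ 𝒜 p) (hb : b ∈ 𝒜 q) : koszulBr l p a b ∈ 𝒜 (p + q + r) := by
  refine sub_mem (zsmul_mem (sub_mem (hl _ _ (hA.2.2.1 _ _ _ ha _ hb)) ?_) _) ?_
  · convert hA.2.2.1 _ _ _ (hl _ _ ha) _ hb using 2; ring
  · convert hA.2.2.1 _ _ _ ha _ (hl _ _ hb) using 2; ring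

theorem mjA (𝒜 : ℤ → Submodule K A) (hA : IsGradedComm 𝒜)
    (d : Module.End K A) (hddeg : HasDeg 𝒜 d 1) (hder : IsGDer 𝒜 1 d)
    (k : ℤ) (bi : Module.End K A) (hbi : IsQuasiBV 𝒜 (-(2 * k)) bi)
    (l : Module.End K A) (hl : l = bi * d - d * bi)
    (hli : IsDiff 𝒜 (-(4 * k) + 1) 2 (l * bi - bi * l))
    (p q u : ℤ) (a b c : A) (ha : a ∈ 𝒜 p) (hb : b ∈ 𝒜 q) (hc : c ∈ 𝒜 u) :
    ((p + q).negOnePow : ℤ) • koszulBr l p a (RA bi b c)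
      - (p.negOnePow : ℤ) • RA bi a (koszulBr l q b c)
    = -((p.negOnePow : ℤ) • koszulBr l (p + q + -(2 * k)) (RA bi a b) c)
      - ((p + q + 1).negOnePow : ℤ) • RA bi (koszulBr l p a b) c
      + (((p + 1) * (q + 1)).negOnePow : ℤ) • (((p + q).negOnePow : ℤ) • koszulBr l q b (RA bi a c)
        - (q.negOnePow : ℤ) • RA bi b (koszulBr l p a c)) := by
  have hldeg : HasDeg 𝒜 l (1 + -(2 * k)) := by
    intro n x hx
    rw [hl]
    refine sub_mem ?_ ?_
    · have h := hbi.1 _ _ (hddeg _ _ hx)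
      rw [show n + 1 + -(2 * k) = n + (1 + -(2 * k)) by ring] at h
      exact h
    · have h := hddeg _ _ (hbi.1 _ _ hx)
      rw [show n + -(2 * k) + 1 = n + (1 + -(2 * k)) by ring] at h
      exact h
  have hR := fun p q a b ha hb => RA_deg 𝒜 hA bi _ hbi.1 p q a b ha hb
  have hQ := fun p q a b ha hb => koszul_deg 𝒜 hA l _ hldeg p q a b ha hb
  have hRo := fun p q a b ha hb => R_op 𝒜 hA k bi hbi p q a b ha hb
  have hQo := fun p q a b ha hb => Q_op 𝒜 hA d hddeg hder k bi hbi l hl p q a b ha hb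
  have hT := hli p a ha q b hb u c hc
  have hT' : (gcomm (-(4 * k) + 1 + p + q) u (gcomm (-(4 * k) + 1 + p) q
    (gcomm (-(4 * k) + 1) p (l * bi - bi * l) a) b) c : Module.End K A) = 0 := hT
  rw [gcomm_eq, gcomm_eq, gcomm_eq] at hT'
  clear hT
  apply LL_inj (K := K)
  simp only [LL_add, LL_sub, LL_neg, LL_zsmul]
  rw [hQo p _ a _ ha (hR q u b c hb hc), hRo p _ a _ ha (hQ q u b c hb hc),
    hQo _ u _ c (hR p q a b ha hb) hc, hRo _ u _ c (hQ p q a b ha hb) hc,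
    hQo q _ b _ hb (hR p u a c ha hc), hRo q _ b _ hb (hQ p u a c ha hc),
    hRo q u b c hb hc, hRo p q a b ha hb, hRo p u a c ha hc,
    hQo q u b c hb hc, hQo p q a b ha hb, hQo p u a c ha hc]
  clear hR hQ hRo hQo hldeg hl hli ha hb hc
  generalize LL K a = a at *
  generalize LL K b = b at *
  generalize LL K c = c at *
  rw [← sub_eq_zero]
  simp only [zE, Int.even_add, Int.even_mul, even_neg, even_two, true_or, iff_true,
    true_iff, Int.not_even_one, (by decide : Even (4 : ℤ))] at hT' ⊢
  by_cases hp : Even p <;> by_cases hq : Even q <;> by_cases hu : Even u <;>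
    simp only [hp, hq, hu, iff_true, iff_false, or_true, true_or, or_self, if_true, if_false,
      not_true_eq_false, not_false_eq_true, iff_self, true_iff, false_iff,
      false_or, or_false, sub_mul, mul_sub, add_mul, mul_add, zero_mul, mul_zero,
      mul_assoc] at hT' ⊢ <;>
  first
  | (refine Eq.trans ?_ hT'; abel1)
  | (refine Eq.trans ?_ (neg_eq_zero.mpr hT'); abel1)
end SfAlg


namespace SfAlg
variable {K : Type} [Field K] {A : Type} [Ring A] [Algebra K A]

/-- `R` restricted to `B` as a bilinear map -/
noncomputable def RB (bi : A →ₗ[K] A) (B : Submodule K A)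
    (hBR : ∀ x ∈ B, ∀ y ∈ B, bi (x * y) - bi x * y - x * bi y ∈ B) : ↥B →ₗ[K] ↥B →ₗ[K] ↥B :=
  LinearMap.mk₂ K (fun x y => ⟨RA bi x y, hBR x x.2 y y.2⟩)
    (by intro x y z; ext; simp [RA, add_mul]; abel)
    (by intro c x y; ext; simp [RA, smul_sub])
    (by intro x y z; ext; simp [RA, mul_add]; abel)
    (by intro c x y; ext; simp [RA, smul_sub])

theorem RB_coe (bi : A →ₗ[K] A) (B : Submodule K A)
    (hBR : ∀ x ∈ B, ∀ y ∈ B, bi (x * y) - bi x * y - x * bi y ∈ B) (x y : ↥B) :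
    (RB bi B hBR x y : A) = RA bi x y := rfl

theorem RA_neg_right (f : A →ₗ[K] A) (x y : A) : RA f x (-y) = - RA f x y := by
  simp only [RA, mul_neg, map_neg]; abel
theorem RA_neg_left (f : A →ₗ[K] A) (x y : A) : RA f (-x) y = - RA f x y := by
  simp only [RA, neg_mul, map_neg]; abel
theorem koszulBr_neg_right (l : A →ₗ[K] A) (n : ℤ) (x y : A) :
    koszulBr l n x (-y) = - koszulBr l n x y := by
  simp only [koszulBr, mul_neg, map_neg]
  rw [sf_nop]
  split_ifs
  · rw [one_smul, one_smul]; abel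
  · rw [neg_smul, neg_smul, one_smul, one_smul]; abel
theorem koszulBr_neg_left (l : A →ₗ[K] A) (n : ℤ) (x y : A) :
    koszulBr l n (-x) y = - koszulBr l n x y := by
  simp only [koszulBr, neg_mul, map_neg]
  rw [sf_nop]
  split_ifs
  · rw [one_smul, one_smul]; abel
  · rw [neg_smul, neg_smul, one_smul, one_smul]; abel

/-- the data needed for the path-object construction, on `B` -/
noncomputable def rB (k : ℤ) (𝒜 : ℤ → Submodule K A) (bi : A →ₗ[K] A) (B : Submodule K A)
    (hBgr : DirectSum.IsInternal (fun n : ℤ => Submodule.comap B.subtype (𝒜 (n + (2 * k - 1)))))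
    (hBR : ∀ x ∈ B, ∀ y ∈ B, bi (x * y) - bi x * y - x * bi y ∈ B) : ↥B →ₗ[K] ↥B →ₗ[K] ↥B :=
  (RB bi B hBR) ∘ₗ (sfSigma _ hBgr)

theorem rB_coe (k : ℤ) (𝒜 : ℤ → Submodule K A) (bi : A →ₗ[K] A) (B : Submodule K A)
    (hBgr : DirectSum.IsInternal (fun n : ℤ => Submodule.comap B.subtype (𝒜 (n + (2 * k - 1)))))
    (hBR : ∀ x ∈ B, ∀ y ∈ B, bi (x * y) - bi x * y - x * bi y ∈ B)
    (p : ℤ) (x y : ↥B) (hx : (x : A) ∈ 𝒜 p) :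
    (rB k 𝒜 bi B hBgr hBR x y : A) = -((p.negOnePow : ℤ) • RA bi x y) := by
  have hx' : x ∈ Submodule.comap B.subtype (𝒜 ((p - (2 * k - 1)) + (2 * k - 1))) := by
    rw [sub_add_cancel]; exact hx
  rw [rB, LinearMap.comp_apply, sfSigma_apply _ hBgr (p - (2 * k - 1)) x hx', map_zsmul,
    LinearMap.smul_apply, Submodule.coe_smul_of_tower, RB_coe]
  simp only [sf_nop, Int.even_sub, Int.even_mul, even_two, Int.not_even_one, true_or]
  by_cases hp : Even p <;> simp [hp]

noncomputable def bB (k : ℤ) (𝒜 : ℤ → Submodule K A) (d bi : A →ₗ[K] A) (B : Submodule K A)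
    (hBgr : DirectSum.IsInternal (fun n : ℤ => Submodule.comap B.subtype (𝒜 (n + (2 * k - 1)))))
    (hBd : ∀ x ∈ B, d x ∈ B)
    (hBR : ∀ x ∈ B, ∀ y ∈ B, bi (x * y) - bi x * y - x * bi y ∈ B) : ↥B →ₗ[K] ↥B →ₗ[K] ↥B :=
  (rB k 𝒜 bi B hBgr hBR).compr₂ (d.restrict hBd) + (rB k 𝒜 bi B hBgr hBR) ∘ₗ (d.restrict hBd)
    + ((rB k 𝒜 bi B hBgr hBR) ∘ₗ (sfSigma _ hBgr)).compl₂ (d.restrict hBd)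

theorem bB_coe (k : ℤ) (𝒜 : ℤ → Submodule K A) (d bi : A →ₗ[K] A) (hddeg : HasDeg 𝒜 d 1)
    (hder : IsGDer 𝒜 1 d) (hbi : HasDeg 𝒜 bi (-(2 * k)))
    (l : A →ₗ[K] A) (hl : l = bi ∘ₗ d - d ∘ₗ bi) (B : Submodule K A)
    (hBgr : DirectSum.IsInternal (fun n : ℤ => Submodule.comap B.subtype (𝒜 (n + (2 * k - 1)))))
    (hBd : ∀ x ∈ B, d x ∈ B)
    (hBR : ∀ x ∈ B, ∀ y ∈ B, bi (x * y) - bi x * y - x * bi y ∈ B)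
    (p : ℤ) (x y : ↥B) (hx : (x : A) ∈ 𝒜 p) :
    (bB k 𝒜 d bi B hBgr hBd hBR x y : A) = koszulBr l p x y := by
  have hx' : x ∈ Submodule.comap B.subtype (𝒜 ((p - (2 * k - 1)) + (2 * k - 1))) := by
    rw [sub_add_cancel]; exact hx
  have hs : (((sfSigma _ hBgr) x : ↥B) : A) ∈ 𝒜 p := by
    rw [sfSigma_apply _ hBgr (p - (2 * k - 1)) x hx']
    exact zsmul_mem hx _
  have e : (bB k 𝒜 d bi B hBgr hBd hBR x y : A) =
      d (rB k 𝒜 bi B hBgr hBR x y : A) + (rB k 𝒜 bi B hBgr hBR (d.restrict hBd x) y : A)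
      + (rB k 𝒜 bi B hBgr hBR (sfSigma _ hBgr x) (d.restrict hBd y) : A) := rfl
  have hdx : ((d.restrict hBd x : ↥B) : A) ∈ 𝒜 (p + 1) := hddeg _ _ hx
  rw [e, rB_coe k 𝒜 bi B hBgr hBR p x y hx, rB_coe k 𝒜 bi B hBgr hBR (p + 1) _ y hdx,
    rB_coe k 𝒜 bi B hBgr hBR p _ _ hs, sfSigma_apply _ hBgr (p - (2 * k - 1)) x hx',
    koszul_eq 𝒜 d hder k bi hbi l hl p x hx]
  simp only [LinearMap.coe_restrict_apply, Submodule.coe_smul_of_tower, map_neg, map_zsmul]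
  simp only [sf_nop, Int.even_sub, Int.even_add, Int.even_mul, even_two, Int.not_even_one, true_or]
  by_cases hp : Even p <;> simp [hp, RA_neg_left]

noncomputable def data (𝒜 : ℤ → Submodule K A) (hA : IsGradedComm 𝒜)
    (d : A →ₗ[K] A) (hddeg : HasDeg 𝒜 d 1) (hder : IsGDer 𝒜 1 d) (hd2 : d ∘ₗ d = 0)
    (k : ℤ) (bi : A →ₗ[K] A) (hbi : IsQuasiBV 𝒜 (-(2 * k)) bi)
    (l : A →ₗ[K] A) (hl : l = bi ∘ₗ d - d ∘ₗ bi)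
    (hli : IsQuasiBV 𝒜 (-(4 * k) + 1) (l ∘ₗ bi - bi ∘ₗ l))
    (B : Submodule K A)
    (hBgr : DirectSum.IsInternal (fun n : ℤ => Submodule.comap B.subtype (𝒜 (n + (2 * k - 1)))))
    (hBd : ∀ x ∈ B, d x ∈ B)
    (hBR : ∀ x ∈ B, ∀ y ∈ B, bi (x * y) - bi x * y - x * bi y ∈ B) : SfData K ↥B where
  gr := fun n : ℤ => Submodule.comap B.subtype (𝒜 (n + (2 * k - 1)))
  internal := hBgr
  d := d.restrict hBd
  d_deg := by
    intro i x hx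
    have h := hddeg _ _ hx
    rw [show i + (2 * k - 1) + 1 = i + 1 + (2 * k - 1) by ring] at h
    exact h
  d_sq := by
    intro x
    ext
    exact congrArg (fun f : A →ₗ[K] A => f (x : A)) hd2
  s := sfSigma _ hBgr
  s_app := fun i x hx => sfSigma_apply _ hBgr i x hx
  r := rB k 𝒜 bi B hBgr hBR
  r_deg := by
    intro i j x hx y hy
    have h := RA_deg 𝒜 hA bi _ hbi.1 _ _ _ _ hx hy
    rw [show i + (2 * k - 1) + (j + (2 * k - 1)) + -(2 * k) = i + j - 1 + (2 * k - 1) by ring] at h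
    change (rB k 𝒜 bi B hBgr hBR x y : A) ∈ 𝒜 _
    rw [rB_coe k 𝒜 bi B hBgr hBR _ x y hx]
    exact neg_mem (zsmul_mem h _)
  r_anti := by
    intro i j x hx y hy
    ext
    rw [Submodule.coe_neg, Submodule.coe_smul_of_tower, rB_coe k 𝒜 bi B hBgr hBR _ x y hx,
      rB_coe k 𝒜 bi B hBgr hBR _ y x hy]
    have h := RA_symm 𝒜 hA bi k hbi.1 _ _ _ _ hx hy
    simp only [Submodule.subtype_apply] at h
    rw [h]
    simp only [sf_nop, Int.even_sub, Int.even_add, Int.even_mul, even_two, Int.not_even_one,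
      true_or]
    by_cases hi : Even i <;> by_cases hj : Even j <;> simp [hi, hj]
  b := bB k 𝒜 d bi B hBgr hBd hBR
  b_def := fun x y => rfl
  mj := by
    intro i j x hx y hy z
    have hRd := fun p x y hx => rB_coe k 𝒜 bi B hBgr hBR p x y hx
    have hBc := fun p x y hx => bB_coe k 𝒜 d bi hddeg hder hbi.1 l hl B hBgr hBd hBR p x y hx
    induction z using sf_hom_induction _ hBgr with
    | h0 => simp
    | hadd z w hz hw =>
      simp only [map_add, smul_add]
      rw [add_add_add_comm, hz, hw]
      simp only [smul_add]
      abel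
    | hh u z hz =>
      have hx' : (x : A) ∈ 𝒜 (i + (2 * k - 1)) := hx
      have hy' : (y : A) ∈ 𝒜 (j + (2 * k - 1)) := hy
      have hz' : (z : A) ∈ 𝒜 (u + (2 * k - 1)) := hz
      have hldeg : HasDeg 𝒜 l (1 + -(2 * k)) := by
        intro n x hx
        rw [hl]
        refine sub_mem ?_ ?_
        · have h := hbi.1 _ _ (hddeg _ _ hx)
          rw [show n + 1 + -(2 * k) = n + (1 + -(2 * k)) by ring] at h
          exact h
        · have h := hddeg _ _ (hbi.1 _ _ hx)
          rw [show n + -(2 * k) + 1 = n + (1 + -(2 * k)) by ring] at h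
          exact h
      have key := mjA 𝒜 hA d hddeg hder k bi hbi l hl hli.2.1 _ _ _ _ _ _ hx' hy' hz'
      have hrxy : (rB k 𝒜 bi B hBgr hBR x y : A)
          ∈ 𝒜 (i + (2 * k - 1) + (j + (2 * k - 1)) + -(2 * k)) := by
        rw [hRd _ x y hx']
        exact neg_mem (zsmul_mem (RA_deg 𝒜 hA bi _ hbi.1 _ _ _ _ hx' hy') _)
      have hbxy : (bB k 𝒜 d bi B hBgr hBd hBR x y : A)
          ∈ 𝒜 (i + (2 * k - 1) + (j + (2 * k - 1)) + (1 + -(2 * k))) := by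
        rw [hBc _ x y hx']
        exact koszul_deg 𝒜 hA l _ hldeg _ _ _ _ hx' hy'
      ext
      simp only [Submodule.coe_add, Submodule.coe_smul_of_tower]
      rw [hBc _ _ z hrxy, hRd _ _ z hbxy]
      simp only [fun w => hBc _ x w hx', fun w => hRd _ x w hx', fun w => hBc _ y w hy',
        fun w => hRd _ y w hy']
      simp only [sf_nop, Int.even_sub, Int.even_add, Int.even_mul, even_two, Int.not_even_one,
        true_or, even_neg] at key ⊢
      by_cases hi : Even i <;> by_cases hj : Even j <;>
        simp only [hi, hj, iff_true, iff_false, or_true, true_or, or_self, if_true, if_false,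
          not_true_eq_false, not_false_eq_true, iff_self, true_iff, false_iff,
          false_or, or_false, one_smul, neg_smul, neg_neg, RA_neg_left, RA_neg_right,
          koszulBr_neg_left, koszulBr_neg_right] at key ⊢
      · linear_combination (norm := module) key
      · linear_combination (norm := module) key
      · linear_combination (norm := module) key
      · linear_combination (norm := module) key
end SfAlg

/-- If `B ⊆ A` is a differential graded linear subspace closed under the
bilinear operator `R(a,b) = i(ab) - i(a)b - a i(b)` , then `(B[2k-1], d, [,]_l)` is a
homotopy abelian (hence formal) DGLA. -/
theorem subcomplex_formality
    (𝒜 : ℤ → Submodule K A) (hA : IsGradedComm 𝒜)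
    (d : A →ₗ[K] A) (hddeg : HasDeg 𝒜 d 1) (hder : IsGDer 𝒜 1 d) (hd2 : d ∘ₗ d = 0)
    (k : ℤ) (bi : A →ₗ[K] A) (hbi : IsQuasiBV 𝒜 (-(2 * k)) bi)
    (l : A →ₗ[K] A) (hl : l = bi ∘ₗ d - d ∘ₗ bi)
    (hli : IsQuasiBV 𝒜 (-(4 * k) + 1) (l ∘ₗ bi - bi ∘ₗ l))
    (B : Submodule K A)
    -- `B` is a graded subspace (so that the induced grading is an internal direct sum):
    (hBgr : DirectSum.IsInternal (fun n : ℤ => Submodule.comap B.subtype (𝒜 (n + (2 * k - 1)))))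
    -- `B` is a subcomplex:
    (hBd : ∀ x ∈ B, d x ∈ B)
    -- `B` is closed under the bilinear operator `R`:
    (hBR : ∀ x ∈ B, ∀ y ∈ B, bi (x * y) - bi x * y - x * bi y ∈ B) :
    ∃ S : DGLAon K ↥B,
      S.grading = (fun n => Submodule.comap B.subtype (𝒜 (n + (2 * k - 1)))) ∧
      (∀ x : ↥B, (S.d x : A) = d (x : A)) ∧
      (∀ i : ℤ, ∀ x : ↥B, (x : A) ∈ 𝒜 i → ∀ y : ↥B,
        (S.bracket x y : A) = koszulBr l i (x : A) (y : A)) ∧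
      HomotopyAbelian K ⟨↥B, S⟩ := by
  let S := SfAlg.data 𝒜 hA d hddeg hder hd2 k bi hbi l hl hli B hBgr hBd hBR
  refine ⟨S.str, rfl, fun x => rfl, ?_, S.homotopyAbelian⟩
  intro i x hx y
  exact SfAlg.bB_coe k 𝒜 d bi hddeg hder hbi.1 l hl B hBgr hBd hBR i x y hx
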